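/- For every n ≥ 4, t₂(n, n−1) = n + 1; that is, the minimum number of edges in a 2-connected graph G on n vertices with rc₂(G) ≤ n − 1 is exactly n + 1. -/

import Mathlib

open SimpleGraph

/-- A walk is rainbow (w.r.t. an edge-colouring `col`) if its edges receive
pairwise distinct colours. -/
def IsRainbowWalk {V α : Type*} {G : SimpleGraph V} {u v : V} (col : Sym2 V → α)
    (p : G.Walk u v) : Prop :=
  (p.edges.map col).Nodup

/-- An edge-colouring is rainbow 2-connected if every two distinct vertices are
connected by two internally vertex-disjoint rainbow paths. -/
def RainbowTwoConnectedColouring {V α : Type*} (G : SimpleGraph V) (col : Sym2 V → α) : Prop :=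
  ∀ u v : V, u ≠ v → ∃ p q : G.Walk u v, p.IsPath ∧ q.IsPath ∧ p ≠ q ∧
    IsRainbowWalk col p ∧ IsRainbowWalk col q ∧
    ∀ w : V, w ∈ p.support → w ∈ q.support → w = u ∨ w = v

/-- The rainbow 2-connection number: the least number of colours in a rainbow
2-connected colouring. -/
noncomputable def rc2 {V : Type*} (G : SimpleGraph V) : ℕ :=
  sInf {r : ℕ | ∃ col : Sym2 V → Fin r, RainbowTwoConnectedColouring G col}

/-- A graph is 2-connected if it has at least 3 vertices and deleting any single
vertex leaves a connected graph. -/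
def TwoConnected {V : Type*} [Fintype V] (G : SimpleGraph V) : Prop :=
  3 ≤ Fintype.card V ∧ ∀ v : V, (G.induce ({v}ᶜ : Set V)).Connected

/-- `t2 n r`: minimum number of edges of a 2-connected graph on `n` vertices
with rainbow 2-connection number at most `r`. -/
noncomputable def t2 (n r : ℕ) : ℕ :=
  sInf {m : ℕ | ∃ G : SimpleGraph (Fin n), TwoConnected G ∧ rc2 G ≤ r ∧ G.edgeSet.ncard = m}

/-- `s2 n r`: maximum number of edges of a 2-connected graph on `n` vertices
with rainbow 2-connection number at least `r`. -/
noncomputable def s2 (n r : ℕ) : ℕ :=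
  sSup {m : ℕ | ∃ G : SimpleGraph (Fin n), TwoConnected G ∧ r ≤ rc2 G ∧ G.edgeSet.ncard = m}


/-- Two distinct, internally disjoint rainbow paths join `u` to `v`. -/
def HasTwoRainbowPaths {V α : Type*} (G : SimpleGraph V) (col : Sym2 V → α) (u v : V) : Prop :=
  ∃ p q : G.Walk u v, p.IsPath ∧ q.IsPath ∧ p ≠ q ∧
    IsRainbowWalk col p ∧ IsRainbowWalk col q ∧
    ∀ w : V, w ∈ p.support → w ∈ q.support → w = u ∨ w = v

namespace IsRainbowWalk

variable {V α : Type*} {G : SimpleGraph V} {col : Sym2 V → α}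

theorem reverse {u v : V} {p : G.Walk u v} (hp : IsRainbowWalk col p) :
    IsRainbowWalk col p.reverse := by
  simpa [IsRainbowWalk] using hp

theorem of_append {u v w : V} {p : G.Walk u v} {q : G.Walk v w}
    (h : IsRainbowWalk col (p.append q)) : IsRainbowWalk col p ∧ IsRainbowWalk col q := by
  simp only [IsRainbowWalk, Walk.edges_append, List.map_append] at h
  exact ⟨h.of_append_left, h.of_append_right⟩

theorem rotate [DecidableEq V] {a u : V} {c : G.Walk a a} (hc : IsRainbowWalk col c)
    (hu : u ∈ c.support) :
    IsRainbowWalk col (c.rotate u hu) :=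
  ((c.rotate_edges u hu).perm.map col).nodup_iff.mpr hc

end IsRainbowWalk

theorem HasTwoRainbowPaths.symm {V α : Type*} {G : SimpleGraph V} {col : Sym2 V → α} {u v : V}
    (h : HasTwoRainbowPaths G col u v) : HasTwoRainbowPaths G col v u := by
  obtain ⟨p, q, hp, hq, hne, hrp, hrq, hd⟩ := h
  refine ⟨p.reverse, q.reverse, hp.reverse, hq.reverse, fun h => hne ?_, hrp.reverse,
    hrq.reverse, fun w h1 h2 => ?_⟩
  · simpa using congrArg Walk.reverse h
  · simp only [Walk.support_reverse, List.mem_reverse] at h1 h2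
    exact (hd w h1 h2).symm

/-- Any two vertices of a rainbow cycle are joined by the two arcs of that cycle. -/
theorem SimpleGraph.Walk.IsCycle.hasTwoRainbowPaths {V α : Type*} {G : SimpleGraph V}
    {col : Sym2 V → α} {a u v : V} {c : G.Walk a a} (hc : c.IsCycle) (hr : IsRainbowWalk col c)
    (hu : u ∈ c.support) (hv : v ∈ c.support) (huv : u ≠ v) : HasTwoRainbowPaths G col u v := by
  classical
  have hd := hc.rotate hu
  have hrd := hr.rotate hu
  have hvd : v ∈ (c.rotate u hu).support := (Walk.mem_support_rotate_iff ..).mpr hv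
  generalize c.rotate u hu = d at hd hrd hvd
  obtain ⟨p, q, rfl⟩ : ∃ (p : G.Walk u v) (q : G.Walk v u), d = p.append q :=
    ⟨_, _, (d.take_spec hvd).symm⟩
  have hp : p.IsPath := by
    have := hd.reverse
    rw [Walk.reverse_append] at this
    exact p.isPath_reverse_iff.mp (this.isPath_of_append_right (Walk.not_nil_of_ne huv))
  have hq : q.IsPath := hd.isPath_of_append_right (Walk.not_nil_of_ne huv)
  obtain ⟨hrp, hrq⟩ := hrd.of_append
  refine ⟨p, q.reverse, hp, hq.reverse, fun h => ?_, hrp, hrq.reverse, fun w h1 h2 => ?_⟩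
  · have hdis := hd.edges_nodup
    rw [Walk.edges_append] at hdis
    have hpe := List.disjoint_of_nodup_append hdis
    have he : q.edges = p.edges.reverse := by rw [h]; simp
    cases p with
    | nil => exact huv rfl
    | @cons _ w _ hadj p' => exact hpe (a := s(u, w)) (by simp) (by rw [he]; simp)
  · have hs := hd.support_nodup
    rw [Walk.tail_support_append] at hs
    have hdis := List.disjoint_of_nodup_append hs
    rw [Walk.support_reverse, List.mem_reverse] at h2
    rw [Walk.mem_support_iff] at h1 h2
    rcases h1 with h1 | h1
    · exact Or.inl h1
    rcases h2 with h2 | h2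
    · exact Or.inr h2
    · exact (hdis h1 h2).elim

/-- A rainbow 2-connected graph is 2-connected. -/
theorem RainbowTwoConnectedColouring.twoConnected {V α : Type*} [Fintype V] {G : SimpleGraph V}
    {col : Sym2 V → α} (h : RainbowTwoConnectedColouring G col) (hV : 3 ≤ Fintype.card V) :
    TwoConnected G := by
  refine ⟨hV, fun w => ?_⟩
  have : Nontrivial V := Fintype.one_lt_card_iff_nontrivial.mp (by omega)
  obtain ⟨x, hx⟩ := exists_ne w
  refine @Connected.mk _ _ (fun ⟨a, ha⟩ ⟨b, hb⟩ => ?_) ⟨⟨x, hx⟩⟩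
  by_cases hab : a = b
  · subst hab; exact Reachable.refl _
  obtain ⟨p, q, -, -, -, -, -, hd⟩ := h a b hab
  simp only [Set.mem_compl_iff, Set.mem_singleton_iff] at ha hb
  by_cases hp : w ∈ p.support
  · by_cases hq : w ∈ q.support
    · rcases hd w hp hq with h | h
      · exact (ha h.symm).elim
      · exact (hb h.symm).elim
    · exact ⟨q.induce _ fun y hy => by rintro rfl; exact hq hy⟩
  · exact ⟨p.induce _ fun y hy => by rintro rfl; exact hp hy⟩

namespace TwoConnected

variable {V : Type*} [Fintype V] {G : SimpleGraph V}

theorem exists_ne_and_ne (h : TwoConnected G) (v w : V) : ∃ x, x ≠ v ∧ x ≠ w := by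
  classical
  obtain ⟨x, -, hx⟩ := Finset.exists_mem_notMem_of_card_lt_card
    (s := ({v, w} : Finset V)) (t := Finset.univ) (Finset.card_le_two.trans_lt h.1)
  exact ⟨x, by simpa using hx⟩

theorem exists_adj_ne (h : TwoConnected G) {v w : V} (hvw : v ≠ w) : ∃ a, G.Adj v a ∧ a ≠ w := by
  obtain ⟨x, hx⟩ := h.exists_ne_and_ne v w
  have : Nontrivial ({w}ᶜ : Set V) := ⟨⟨v, hvw⟩, ⟨x, hx.2⟩,
    fun e => hx.1 (congrArg Subtype.val e).symm⟩
  obtain ⟨⟨a, ha⟩, hadj⟩ := (h.2 w).preconnected.exists_adj_of_nontrivial ⟨v, hvw⟩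
  exact ⟨a, hadj, ha⟩

theorem connected (h : TwoConnected G) : G.Connected := by
  have : Nonempty V := Fintype.card_pos_iff.mp (by have := h.1; omega)
  refine ⟨fun u v => ?_⟩
  obtain ⟨x, hx⟩ := h.exists_ne_and_ne u v
  exact ((h.2 x).preconnected ⟨u, Ne.symm hx.1⟩ ⟨v, Ne.symm hx.2⟩).map
    (Embedding.induce _).toHom

theorem two_le_degree (h : TwoConnected G) [DecidableRel G.Adj] (v : V) : 2 ≤ G.degree v := by
  classical
  have : Nontrivial V := Fintype.one_lt_card_iff_nontrivial.mp (by have := h.1; omega)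
  obtain ⟨w, hw⟩ := exists_ne v
  obtain ⟨a, ha, -⟩ := h.exists_adj_ne hw.symm
  obtain ⟨b, hb, hba⟩ := h.exists_adj_ne ha.ne
  rw [← G.card_neighborFinset_eq_degree]
  calc 2 = ({b, a} : Finset V).card := (Finset.card_pair hba).symm
    _ ≤ _ := Finset.card_le_card (by simp [Finset.insert_subset_iff, ha, hb])

theorem card_le_card_edgeFinset (h : TwoConnected G) [DecidableRel G.Adj] :
    Fintype.card V ≤ G.edgeFinset.card := by
  have h1 := G.sum_degrees_eq_twice_card_edges
  have h2 : ∑ _v : V, 2 ≤ ∑ v, G.degree v := Finset.sum_le_sum fun v _ => h.two_le_degree v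
  simp at h2
  omega

theorem degree_eq_two (h : TwoConnected G) [DecidableRel G.Adj]
    (hcard : G.edgeFinset.card ≤ Fintype.card V) (v : V) : G.degree v = 2 := by
  have h1 := G.sum_degrees_eq_twice_card_edges
  have h2 : ∑ _v : V, 2 = ∑ v, G.degree v :=
    le_antisymm (Finset.sum_le_sum fun v _ => h.two_le_degree v) (by simp; omega)
  exact ((Finset.sum_eq_sum_iff_of_le fun v _ => h.two_le_degree v).mp h2 v
    (Finset.mem_univ v)).symm

end TwoConnected

section Spanning

variable {V : Type*} [Fintype V] {G : SimpleGraph V} [DecidableRel G.Adj] {a : V} {c : G.Walk a a}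

theorem SimpleGraph.Walk.IsCycle.mem_edges_of_degree_eq_two (hc : c.IsCycle)
    (hdeg : ∀ v, G.degree v = 2) {u v : V} (hu : u ∈ c.support) (huv : G.Adj u v) :
    s(u, v) ∈ c.edges := by
  have h2 := hc.ncard_neighborSet_toSubgraph_eq_two hu
  have h3 : (G.neighborSet u).ncard = 2 := by
    rw [← hdeg u, ← G.card_neighborSet_eq_degree u, Set.ncard_eq_toFinset_card', Set.toFinset_card]
  have h4 := Set.eq_of_subset_of_ncard_le (c.toSubgraph.neighborSet_subset u)
    (by omega) (Set.toFinite _)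
  have h5 : v ∈ c.toSubgraph.neighborSet u := by rw [h4]; exact huv
  exact Walk.adj_toSubgraph_iff_mem_edges.mp h5

theorem SimpleGraph.Walk.IsCycle.mem_support_of_degree_eq_two (hc : c.IsCycle)
    (hconn : G.Connected) (hdeg : ∀ v, G.degree v = 2) (v : V) : v ∈ c.support := by
  obtain ⟨p⟩ := hconn.preconnected a v
  have key : ∀ {x y : V} (p : G.Walk x y), x ∈ c.support → y ∈ c.support := by
    intro x y p
    induction p with
    | nil => exact id
    | cons hadj p ih =>
      exact fun hx => ih (c.snd_mem_support_of_mem_edges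
        (hc.mem_edges_of_degree_eq_two hdeg hx hadj))
  exact key p c.start_mem_support

end Spanning

/-- In a connected 2-regular graph, a rainbow 2-connected colouring is injective on edges. -/
theorem RainbowTwoConnectedColouring.injOn_of_degree_eq_two {V α : Type*} [Fintype V]
    {G : SimpleGraph V} [DecidableRel G.Adj] {col : Sym2 V → α}
    (h : RainbowTwoConnectedColouring G col) (hconn : G.Connected)
    (hdeg : ∀ v, G.degree v = 2) (hcard : 3 ≤ G.edgeFinset.card) :
    Set.InjOn col G.edgeSet := by
  classical
  intro e₁ h₁ e₂ h₂ heq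
  obtain ⟨e, he, hne⟩ : ∃ e ∈ G.edgeFinset, e ∉ ({e₁, e₂} : Finset (Sym2 V)) := by
    by_contra! hall
    have h1 := Finset.card_le_card (show G.edgeFinset ⊆ {e₁, e₂} from hall)
    have h2 : ({e₁, e₂} : Finset (Sym2 V)).card ≤ 2 := Finset.card_le_two
    omega
  simp only [Finset.mem_insert, Finset.mem_singleton, not_or] at hne
  rw [mem_edgeFinset] at he
  induction e with | _ u v
  have hadj : G.Adj u v := he
  have key : ∀ q : G.Walk u v, q.IsPath → IsRainbowWalk col q → s(u, v) ∉ q.edges → e₁ = e₂ := by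
    intro q hq hrq hnot
    have hcyc : (Walk.cons hadj.symm q).IsCycle :=
      (Walk.cons_isCycle_iff _ _).mpr ⟨hq, by rwa [Sym2.eq_swap]⟩
    have hmem : ∀ e ∈ G.edgeSet, e ≠ s(u, v) → e ∈ q.edges := by
      intro e he hne
      induction e with | _ x y
      have := hcyc.mem_edges_of_degree_eq_two hdeg
        (hcyc.mem_support_of_degree_eq_two hconn hdeg x) he
      rw [Walk.edges_cons, List.mem_cons, Sym2.eq_swap (a := v)] at this
      exact this.resolve_left hne
    exact List.inj_on_of_nodup_map hrq (hmem e₁ h₁ (Ne.symm hne.1)) (hmem e₂ h₂ (Ne.symm hne.2)) heq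
  obtain ⟨p, q, hp, hq, hpq, hrp, hrq, hd⟩ := h u v hadj.ne
  by_cases hup : s(u, v) ∈ p.edges
  · refine key q hq hrq fun huq => hpq ?_
    have unique : ∀ r : G.Walk u v, r.IsPath → s(u, v) ∈ r.edges → r = Walk.cons hadj .nil := by
      intro r hr hmem
      by_contra hne'
      cases r with
      | nil => simp at hmem
      | @cons _ w _ hw r' =>
        rw [Walk.cons_isPath_iff] at hr
        rw [Walk.edges_cons, List.mem_cons] at hmem
        rcases hmem with hmem | hmem
        · have : v = w := by simpa [Sym2.eq_iff, hw.ne] using hmem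
          subst this
          rw [Walk.eq_nil_iff_nil.mpr (Walk.isPath_iff_nil.mp hr.1)] at hne'
          exact hne' rfl
        · exact hr.2 (r'.fst_mem_support_of_mem_edges hmem)
    rw [unique p hp hup, unique q hq huq]
  · exact key p hp hrp hup

/-- A 2-connected graph with at most as many edges as vertices is a cycle, so it needs as many
colours as it has vertices. -/
theorem TwoConnected.card_le_rc2 {V : Type*} [Fintype V] {G : SimpleGraph V} [DecidableRel G.Adj]
    (h : TwoConnected G) (hcard : G.edgeFinset.card ≤ Fintype.card V) :
    Fintype.card V ≤ rc2 G := by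
  classical
  have hconn := h.connected
  have hdeg := h.degree_eq_two hcard
  have hle := h.card_le_card_edgeFinset
  have hne : {r : ℕ | ∃ col : Sym2 V → Fin r, RainbowTwoConnectedColouring G col}.Nonempty := by
    have hcyc : ¬ G.IsAcyclic := fun hac => by
      have := (IsTree.mk hconn hac).card_edgeFinset
      omega
    simp only [IsAcyclic, not_forall, not_not] at hcyc
    obtain ⟨a, c, hc⟩ := hcyc
    refine ⟨_, Fintype.equivFin (Sym2 V), fun u v huv => hc.hasTwoRainbowPaths ?_
      (hc.mem_support_of_degree_eq_two hconn hdeg u)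
      (hc.mem_support_of_degree_eq_two hconn hdeg v) huv⟩
    exact hc.edges_nodup.map (Fintype.equivFin (Sym2 V)).injective
  obtain ⟨col, hcol⟩ : ∃ col : Sym2 V → Fin (rc2 G), RainbowTwoConnectedColouring G col :=
    Nat.sInf_mem hne
  have hinj := hcol.injOn_of_degree_eq_two hconn hdeg (h.1.trans hle)
  calc Fintype.card V ≤ G.edgeFinset.card := hle
    _ ≤ (Finset.univ : Finset (Fin (rc2 G))).card :=
      Finset.card_le_card_of_injOn col (fun _ _ => Finset.mem_univ _) (by simpa using hinj)
    _ = rc2 G := by simp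

theorem rc2_le_of_forall_lt {V : Type*} {G : SimpleGraph V} {col : Sym2 V → ℕ} {r : ℕ}
    (h : RainbowTwoConnectedColouring G col) (hr : ∀ e, col e < r) : rc2 G ≤ r := by
  have lift : ∀ {u v : V} (p : G.Walk u v), IsRainbowWalk col p →
      IsRainbowWalk (fun e => (⟨col e, hr e⟩ : Fin r)) p := fun p hp =>
    List.Nodup.of_map Fin.val (by rw [List.map_map]; exact hp)
  refine Nat.sInf_le ⟨fun e => ⟨col e, hr e⟩, fun u v huv => ?_⟩
  obtain ⟨p, q, hp, hq, hne, hrp, hrq, hd⟩ := h u v huv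
  exact ⟨p, q, hp, hq, hne, lift p hrp, lift q hrq, hd⟩

/-- The cycle `0, 1, …, k + 1` together with the chord `{0, k}`. -/
def chordedCycle (k : ℕ) : SimpleGraph (Fin (k + 2)) :=
  SimpleGraph.fromRel fun i j =>
    i.val + 1 = j.val ∨ (i.val = 0 ∧ (j.val = k ∨ j.val = k + 1))

namespace chordedCycle

variable {k : ℕ}

/-- The edge `{i, i + 1}` with `i < k` gets colour `i` and the chord gets colour `k`. The edges at
`k + 1` repeat the colour of the chain edge at the opposite end of the chord. -/
def colour (k : ℕ) (e : Sym2 (Fin (k + 2))) : ℕ :=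
  if e.sup.val = k + 1 then (if e.inf.val = 0 then k - 1 else 0)
  else if e.sup.val = e.inf.val + 1 then e.inf.val else k

theorem colour_lt (e : Sym2 (Fin (k + 2))) : colour k e < k + 1 := by
  have := e.sup.isLt
  unfold colour
  split_ifs <;> omega

theorem colour_mk {a b : Fin (k + 2)} (h : a ≤ b) : colour k s(a, b) =
    if b.val = k + 1 then (if a.val = 0 then k - 1 else 0)
    else if b.val = a.val + 1 then a.val else k := by
  simp [colour, sup_eq_right.mpr h, inf_eq_left.mpr h]

theorem adj_of_lt {a b : Fin (k + 2)} (hab : a < b)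
    (h : a.val + 1 = b.val ∨ (a.val = 0 ∧ (b.val = k ∨ b.val = k + 1))) :
    (chordedCycle k).Adj a b :=
  (SimpleGraph.fromRel_adj _ _ _).mpr ⟨hab.ne, Or.inl h⟩

theorem exists_chain {d : ℕ} : ∀ {a b : Fin (k + 2)}, a.val + d = b.val → b.val ≤ k →
    ∃ p : (chordedCycle k).Walk a b, p.IsPath ∧ (∀ w, w ∈ p.support ↔ a ≤ w ∧ w ≤ b) ∧
      p.edges.map (colour k) = List.range' a.val d := by
  induction d with
  | zero =>
    intro a b hab _
    obtain rfl : a = b := Fin.ext hab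
    exact ⟨.nil, by simp, fun w => by simp [le_antisymm_iff, and_comm], by simp⟩
  | succ d ih =>
    intro a b hab hb
    let a' : Fin (k + 2) := ⟨a.val + 1, by omega⟩
    have haa : a < a' := Fin.lt_def.mpr (Nat.lt_succ_self _)
    obtain ⟨p, hp, hs, hc⟩ := ih (a := a') (b := b) (by simp only [a']; omega) hb
    refine ⟨.cons (adj_of_lt haa (Or.inl rfl)) p, ?_, fun w => ?_, ?_⟩
    · rw [Walk.cons_isPath_iff]
      exact ⟨hp, fun h => absurd ((hs a).mp h).1 (not_le.mpr haa)⟩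
    · rw [Walk.support_cons, List.mem_cons, hs]
      simp only [Fin.ext_iff, Fin.le_def, a']
      omega
    · rw [Walk.edges_cons, List.map_cons, hc, colour_mk haa.le, List.range'_succ,
        if_neg (by simp only [a']; omega), if_pos rfl]

theorem hasTwoRainbowPaths_of_le {u v : Fin (k + 2)} (hk : 2 ≤ k) (hu : u.val ≤ k)
    (hv : v.val ≤ k) (huv : u ≠ v) : HasTwoRainbowPaths (chordedCycle k) (colour k) u v := by
  let z : Fin (k + 2) := 0
  let y : Fin (k + 2) := ⟨k, by omega⟩
  have hzy : z < y := Fin.lt_def.mpr (by simp [z, y]; omega)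
  obtain ⟨p, hp, hs, hc⟩ := exists_chain (d := k) (a := z) (b := y) (by simp [z, y]) le_rfl
  have hcol : colour k s(y, z) = k := by
    rw [Sym2.eq_swap, colour_mk hzy.le, if_neg (by simp [y]), if_neg (by simp [y, z]; omega)]
  have hadj : (chordedCycle k).Adj z y := adj_of_lt hzy (Or.inr ⟨rfl, Or.inl rfl⟩)
  have hk' : k ∉ List.range' z.val k := by simp [List.mem_range'_1, z]
  refine Walk.IsCycle.hasTwoRainbowPaths (c := .cons hadj.symm p) ?_ ?_ ?_ ?_ huv
  · rw [Walk.cons_isCycle_iff]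
    refine ⟨hp, fun h => hk' ?_⟩
    rw [← hc]
    exact List.mem_map.mpr ⟨_, h, hcol⟩
  · rw [IsRainbowWalk, Walk.edges_cons, List.map_cons, hc, hcol, List.nodup_cons]
    exact ⟨hk', List.nodup_range'⟩
  · exact List.mem_cons_of_mem _ ((hs u).mpr ⟨Fin.zero_le u, hu⟩)
  · exact List.mem_cons_of_mem _ ((hs v).mpr ⟨Fin.zero_le v, hv⟩)

theorem hasTwoRainbowPaths_last {v : Fin (k + 2)} (hk : 2 ≤ k) (hv : v.val ≤ k) :
    HasTwoRainbowPaths (chordedCycle k) (colour k) (Fin.last (k + 1)) v := by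
  let x : Fin (k + 2) := Fin.last (k + 1)
  let z : Fin (k + 2) := 0
  let y : Fin (k + 2) := ⟨k, by omega⟩
  have hzy : z < y := Fin.lt_def.mpr (by simp [z, y]; omega)
  have hyx : y < x := Fin.lt_def.mpr (by simp [x, y])
  have hzx : z < x := hzy.trans hyx
  have hvx : v < x := Fin.lt_def.mpr (by simp [x]; omega)
  have azy : (chordedCycle k).Adj z y := adj_of_lt hzy (Or.inr ⟨rfl, Or.inl rfl⟩)
  have azx : (chordedCycle k).Adj z x := adj_of_lt hzx (Or.inr ⟨rfl, Or.inr rfl⟩)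
  have ayx : (chordedCycle k).Adj y x := adj_of_lt hyx (Or.inl rfl)
  have czy : colour k s(z, y) = k := by
    rw [colour_mk hzy.le, if_neg (by simp [y]), if_neg (by simp [y, z]; omega)]
  have czx : colour k s(z, x) = k - 1 := by
    rw [colour_mk hzx.le, if_pos (by simp [x]), if_pos (by simp [z])]
  have cyx : colour k s(y, x) = 0 := by
    rw [colour_mk hyx.le, if_pos (by simp [x]), if_neg (by simp only [y]; omega)]
  change HasTwoRainbowPaths _ _ x v
  by_cases hvzy : v = z ∨ v = y
  · refine Walk.IsCycle.hasTwoRainbowPaths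
      (c := .cons azx.symm (.cons azy (.cons ayx .nil))) ?_ ?_ (by simp) ?_ hvx.ne'
    · rw [Walk.cons_isCycle_iff]
      simp [hzy.ne, hzx.ne, hyx.ne, hzx.ne', hyx.ne']
    · simp only [IsRainbowWalk, Walk.edges_cons, Walk.edges_nil, List.map_cons, List.map_nil,
        czy, cyx, Sym2.eq_swap (a := x), czx]
      simp
      omega
    · rcases hvzy with h | h <;> simp [h]
  push Not at hvzy
  have hv0 : v.val ≠ 0 := fun h => hvzy.1 (Fin.ext h)
  have hvk : v.val ≠ k := fun h => hvzy.2 (Fin.ext h)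
  obtain ⟨p, hp, hps, hpc⟩ := exists_chain (d := v.val) (a := z) (b := v) (by simp [z]) hv
  obtain ⟨q, hq, hqs, hqc⟩ := exists_chain (d := k - v.val) (a := v) (b := y)
    (by simp only [y]; omega) le_rfl
  have hxp : x ∉ p.support := fun h => absurd ((hps x).mp h).2 (not_le.mpr hvx)
  have hxq : x ∉ q.support := fun h => absurd ((hqs x).mp h).2 (not_le.mpr hyx)
  refine ⟨.cons azx.symm p, .cons ayx.symm q.reverse, ?_, ?_, fun h => ?_, ?_, ?_,
    fun w h1 h2 => ?_⟩
  · exact (Walk.cons_isPath_iff _ _).mpr ⟨hp, hxp⟩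
  · exact (Walk.cons_isPath_iff _ _).mpr ⟨hq.reverse, by simpa using hxq⟩
  · have hz : z ∈ (Walk.cons azx.symm p).support := by simp
    rw [h, Walk.support_cons, List.mem_cons, Walk.support_reverse, List.mem_reverse, hqs] at hz
    rcases hz with hz | hz
    · exact hzx.ne hz
    · exact hv0 (Nat.le_zero.mp hz.1)
  · rw [IsRainbowWalk, Walk.edges_cons, List.map_cons, hpc, Sym2.eq_swap, czx, List.nodup_cons]
    refine ⟨?_, List.nodup_range'⟩
    simp only [List.mem_range'_1, z, Fin.val_zero]
    omega
  · rw [IsRainbowWalk, Walk.edges_cons, List.map_cons, Walk.edges_reverse, List.map_reverse, hqc,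
      Sym2.eq_swap, cyx, List.nodup_cons, List.nodup_reverse, List.mem_reverse]
    refine ⟨?_, List.nodup_range'⟩
    simp only [List.mem_range'_1]
    omega
  · rw [Walk.support_cons, List.mem_cons, hps] at h1
    rw [Walk.support_cons, List.mem_cons, Walk.support_reverse, List.mem_reverse, hqs] at h2
    rcases h1 with h1 | h1
    · exact Or.inl h1
    rcases h2 with h2 | h2
    · exact Or.inl h2
    · exact Or.inr (le_antisymm h1.2 h2.1)

theorem rainbowTwoConnectedColouring (hk : 2 ≤ k) :
    RainbowTwoConnectedColouring (chordedCycle k) (colour k) := by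
  intro u v huv
  have le_of_ne : ∀ {w : Fin (k + 2)}, w ≠ Fin.last (k + 1) → w.val ≤ k := fun {w} hw =>
    Nat.lt_succ_iff.mp (Fin.val_lt_last hw)
  by_cases hu : u = Fin.last (k + 1)
  · subst hu
    exact hasTwoRainbowPaths_last hk (le_of_ne huv.symm)
  by_cases hv : v = Fin.last (k + 1)
  · subst hv
    exact (hasTwoRainbowPaths_last hk (le_of_ne hu)).symm
  exact hasTwoRainbowPaths_of_le hk (le_of_ne hu) (le_of_ne hv) huv

theorem ncard_edgeSet_le : (chordedCycle k).edgeSet.ncard ≤ k + 3 := by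
  let f : Fin (k + 2) → Sym2 (Fin (k + 2)) := fun i => s(i, i + 1)
  let e : Sym2 (Fin (k + 2)) := s(0, ⟨k, by omega⟩)
  have hsub : (chordedCycle k).edgeSet ⊆ insert e (Set.range f) := by
    have key : ∀ i j : Fin (k + 2),
        (i.val + 1 = j.val ∨ (i.val = 0 ∧ (j.val = k ∨ j.val = k + 1))) →
          s(i, j) ∈ insert e (Set.range f) := by
      rintro i j (h | ⟨h, h' | h'⟩)
      · refine Or.inr ⟨i, ?_⟩
        have : i + 1 = j :=
          Fin.ext (by rw [Fin.val_add_one_of_lt (Fin.lt_def.mpr (by simp; omega)), h])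
        simp [f, this]
      · refine Or.inl ?_
        rw [show i = 0 from Fin.ext h, show j = ⟨k, by omega⟩ from Fin.ext h']
      · refine Or.inr ⟨Fin.last (k + 1), ?_⟩
        rw [show i = 0 from Fin.ext h, show j = Fin.last (k + 1) from Fin.ext h', Sym2.eq_swap]
        simp [f]
    intro e' he'
    induction e' with | _ i j
    obtain ⟨-, h | h⟩ := (SimpleGraph.fromRel_adj _ _ _).mp (show (chordedCycle k).Adj i j from he')
    · exact key i j h
    · rw [Sym2.eq_swap]
      exact key j i h
  calc (chordedCycle k).edgeSet.ncard ≤ (insert e (Set.range f)).ncard :=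
        Set.ncard_le_ncard hsub (Set.toFinite _)
    _ ≤ (Set.range f).ncard + 1 := Set.ncard_insert_le _ _
    _ ≤ k + 3 := by
      have h := Set.ncard_image_le (f := f) (s := Set.univ) (Set.toFinite _)
      rw [Set.image_univ, Set.ncard_univ, Nat.card_eq_fintype_card, Fintype.card_fin] at h
      omega

end chordedCycle

/-- For n ≥ 4, t₂(n, n−1) = n + 1. -/
theorem stmt12 (n : ℕ) (hn : 4 ≤ n) : t2 n (n - 1) = n + 1 := by
  classical
  obtain ⟨k, rfl⟩ : ∃ k, n = k + 2 := ⟨n - 2, by omega⟩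
  have hk : 2 ≤ k := by omega
  have hcol := chordedCycle.rainbowTwoConnectedColouring hk
  have hmem : (chordedCycle k).edgeSet.ncard ∈ {m : ℕ | ∃ G : SimpleGraph (Fin (k + 2)),
      TwoConnected G ∧ rc2 G ≤ k + 2 - 1 ∧ G.edgeSet.ncard = m} :=
    ⟨_, hcol.twoConnected (by simp; omega),
      rc2_le_of_forall_lt hcol chordedCycle.colour_lt, rfl⟩
  refine le_antisymm ((Nat.sInf_le hmem).trans chordedCycle.ncard_edgeSet_le) ?_
  obtain ⟨G, h2, hrc, hG⟩ := Nat.sInf_mem ⟨_, hmem⟩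
  change _ ≤ sInf _
  rw [← hG]
  by_contra! hlt
  rw [Set.ncard_eq_toFinset_card'] at hlt
  have := h2.card_le_rc2 (by rw [Fintype.card_fin]; exact Nat.lt_succ_iff.mp hlt)
  rw [Fintype.card_fin] at this
  omega
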